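/- Let K be an irreducible kernel on a countable set X with all convolution powers finite. For a finite subset Y ⊆ X, let K_Y := (k(x,y))_{x,y∈Y} be the restriction of K to Y, call Y irreducible if K_Y is an irreducible kernel on Y, and let ρ(K_Y) := limsup_{n→∞} (k_Y^(n)(x,x))^{1/n} (independent of x ∈ Y), where k_Y^(n) denotes the n-fold convolution of K_Y with itself within Y. Then ρ(K) = sup_Y ρ(K_Y), where the supremum is taken over all finite irreducible subsets Y ⊆ X. -/

import Mathlib

open Filter
open scoped ENNReal NNReal

/-- Convolution powers of a kernel: `k^(0)(x,y) = 1` if `x = y` and `0` otherwise, and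
`k^(n+1)(x,y) = Σ_z k^(n)(x,z) * k(z,y)`. -/
noncomputable def kpow {X : Type*} [DecidableEq X] (k : X → X → ℝ≥0∞) : ℕ → X → X → ℝ≥0∞
  | 0 => fun x y => if x = y then 1 else 0
  | n + 1 => fun x y => ∑' z, kpow k n x z * k z y

/-- A kernel is irreducible if for all `x, y` there is `l ≥ 1` with `k^(l)(x,y) > 0`. -/
def KIrred {X : Type*} [DecidableEq X] (k : X → X → ℝ≥0∞) : Prop :=
  ∀ x y, ∃ l, 1 ≤ l ∧ 0 < kpow k l x y

/-- The Green function `G(x,y|z) = Σ_n k^(n)(x,y) * zⁿ`. -/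
noncomputable def green {X : Type*} [DecidableEq X] (k : X → X → ℝ≥0∞) (x y : X)
    (z : ℝ≥0∞) : ℝ≥0∞ :=
  ∑' n, kpow k n x y * z ^ n

/-- The radius of convergence of the Green function `G(x,y|·)`: the supremum of the set of
`z` at which the series converges (is finite). -/
noncomputable def convRadius {X : Type*} [DecidableEq X] (k : X → X → ℝ≥0∞) (x y : X) : ℝ≥0∞ :=
  sSup {z : ℝ≥0∞ | green k x y z ≠ ⊤}

/-- `limsup_n (k^(n)(x,y))^{1/n}`. -/
noncomputable def rhoAt {X : Type*} [DecidableEq X] (k : X → X → ℝ≥0∞) (x y : X) : ℝ≥0∞ :=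
  Filter.limsup (fun n : ℕ => (kpow k n x y) ^ (1 / (n : ℝ))) Filter.atTop

/-- The restriction of a kernel to a finite set, extended by zero to the whole space. -/
noncomputable def kres {X : Type*} [DecidableEq X] (Y : Finset X) (k : X → X → ℝ≥0∞) :
    X → X → ℝ≥0∞ :=
  fun a b => if a ∈ Y ∧ b ∈ Y then k a b else 0

section KernelPowers

variable {X : Type*} [DecidableEq X] {k k' : X → X → ℝ≥0∞}

lemma kpow_mono (h : ∀ x y, k x y ≤ k' x y) (n : ℕ) (x y : X) :
    kpow k n x y ≤ kpow k' n x y := by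
  induction n generalizing y with
  | zero => exact le_rfl
  | succ n ih => exact ENNReal.tsum_le_tsum fun z => mul_le_mul' (ih z) (h z y)

lemma kpow_mul_le_kpow_add (k : X → X → ℝ≥0∞) (m n : ℕ) (x y z : X) :
    kpow k m x z * kpow k n z y ≤ kpow k (m + n) x y := by
  induction n generalizing y with
  | zero => by_cases h : z = y <;> simp [kpow, h]
  | succ n ih =>
    simp only [kpow, ← ENNReal.tsum_mul_left, ← mul_assoc]
    exact ENNReal.tsum_le_tsum fun w => mul_le_mul' (ih w) le_rfl

lemma kpow_add_pos {m n : ℕ} {x y z : X} (h₁ : 0 < kpow k m x z) (h₂ : 0 < kpow k n z y) :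
    0 < kpow k (m + n) x y :=
  (ENNReal.mul_pos h₁.ne' h₂.ne').trans_le (kpow_mul_le_kpow_add k m n x y z)

lemma kpow_one (k : X → X → ℝ≥0∞) (x y : X) : kpow k 1 x y = k x y := by
  simp only [kpow]
  rw [tsum_eq_single x (fun z hz => by simp [hz.symm])]
  simp

lemma kpow_pow_le (k : X → X → ℝ≥0∞) (n m : ℕ) (x : X) :
    kpow k n x x ^ m ≤ kpow k (n * m) x x := by
  induction m with
  | zero => simp [kpow]
  | succ m ih =>
    rw [pow_succ, Nat.mul_succ]
    exact (mul_le_mul' ih le_rfl).trans (kpow_mul_le_kpow_add k _ _ x x x)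

lemma kres_le (Y : Finset X) (k : X → X → ℝ≥0∞) (a b : X) : kres Y k a b ≤ k a b := by
  unfold kres
  split_ifs <;> simp

lemma kres_mono {Y Z : Finset X} (h : Y ⊆ Z) (k : X → X → ℝ≥0∞) (a b : X) :
    kres Y k a b ≤ kres Z k a b := by
  by_cases hab : a ∈ Y ∧ b ∈ Y
  · simp [kres, hab, h hab.1, h hab.2]
  · simp [kres, hab]

lemma kpow_subtype (Y : Finset X) (k : X → X → ℝ≥0∞) (n : ℕ) (a b : ↥Y) :
    kpow (fun a b : ↥Y => k a b) n a b = kpow (kres Y k) n a b := by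
  induction n generalizing b with
  | zero => exact if_congr Subtype.ext_iff rfl rfl
  | succ n ih =>
    simp only [kpow]
    rw [← (Subtype.val_injective (p := (· ∈ Y))).tsum_eq]
    · refine tsum_congr fun z => ?_
      rw [ih]
      simp [kres]
    · intro z hz
      by_contra hzY
      have : z ∉ Y := by simpa using hzY
      simp [kres, this] at hz

lemma kpow_subtype_le (Y : Finset X) (k : X → X → ℝ≥0∞) (n : ℕ) (a b : ↥Y) :
    kpow (fun a b : ↥Y => k a b) n a b ≤ kpow k n a b :=
  (kpow_subtype Y k n a b).trans_le (kpow_mono (kres_le Y k) n a b)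

/-- Powers of a kernel are the suprema of the powers of its finite restrictions. -/
lemma kpow_le_iSup_kres (k : X → X → ℝ≥0∞) (n : ℕ) (x y : X) :
    kpow k n x y ≤ ⨆ Y : Finset X, kpow (kres Y k) n x y := by
  induction n generalizing y with
  | zero => simp [kpow]
  | succ n ih =>
    have hterm (z : X) : kpow k n x z * k z y ≤
        ⨆ Y : Finset X, kpow (kres Y k) n x z * kres Y k z y := by
      refine (mul_le_mul' (ih z) le_rfl).trans ?_
      rw [ENNReal.iSup_mul]
      refine iSup_le fun Y => le_iSup_of_le (Y ∪ {z, y}) (mul_le_mul' ?_ ?_)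
      · exact kpow_mono (kres_mono Finset.subset_union_left k) n x z
      · simp [kres]
    simp only [kpow]
    refine (ENNReal.tsum_le_tsum hterm).trans ?_
    rw [ENNReal.tsum_eq_iSup_sum]
    refine iSup_le fun s => ?_
    rw [ENNReal.finsetSum_iSup_of_monotone]
    · exact iSup_mono fun Y => ENNReal.sum_le_tsum s
    · exact fun z Y Z h => mul_le_mul' (kpow_mono (kres_mono h k) n x z) (kres_mono h k z y)

/-- A return path inside a finite set stays in a finite irreducible set. -/
lemma exists_irreducible_kpow_le (k : X → X → ℝ≥0∞) (F : Finset X) {n : ℕ} (hn : 1 ≤ n) {x : X}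
    (hpos : 0 < kpow (kres F k) n x x) :
    ∃ Y : Finset X, KIrred (fun a b : ↥Y => k a b) ∧ ∃ y : ↥Y, (y : X) = x ∧
      kpow (kres F k) n x x ≤ kpow (fun a b : ↥Y => k a b) n y y := by
  classical
  set q := kres F k with hq
  have hmem {a b : X} (h : q a b ≠ 0) : a ∈ F ∧ b ∈ F := by
    by_contra hab
    exact h (by simp [hq, kres, hab])
  have hx : x ∈ F := by
    obtain ⟨m, rfl⟩ := Nat.exists_eq_add_of_le' hn
    by_contra hx
    simp [kpow, hq, kres, hx] at hpos
  set Y := F.filter fun z => (∃ l, 0 < kpow q l x z) ∧ ∃ m, 0 < kpow q m z x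
  have hstep {a b : X} (ha : a ∈ Y) (hb : b ∈ Y) (m : ℕ) :
      kpow q m a b ≤ kpow (kres Y k) m a b := by
    induction m generalizing b with
    | zero => exact le_rfl
    | succ m ih =>
      refine ENNReal.tsum_le_tsum fun w => ?_
      by_cases hw : kpow q m a w * q w b = 0
      · simp [hw]
      obtain ⟨haw, hwb⟩ := mul_ne_zero_iff.1 hw
      obtain ⟨hwF, hbF⟩ := hmem hwb
      obtain ⟨-, ⟨l, hl⟩, -⟩ := Finset.mem_filter.1 ha
      obtain ⟨-, -, l', hl'⟩ := Finset.mem_filter.1 hb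
      have hwY : w ∈ Y := Finset.mem_filter.2 ⟨hwF, ⟨_, kpow_add_pos hl (pos_iff_ne_zero.2 haw)⟩,
        ⟨_, kpow_add_pos (m := 1) (by rw [kpow_one]; exact pos_iff_ne_zero.2 hwb) hl'⟩⟩
      refine mul_le_mul' (ih hwY) ?_
      simp [hq, kres, hwF, hbF, hwY, hb]
  have hxY : x ∈ Y := Finset.mem_filter.2 ⟨hx, ⟨n, hpos⟩, ⟨n, hpos⟩⟩
  refine ⟨Y, fun a b => ?_, ⟨x, hxY⟩, rfl, ?_⟩
  · obtain ⟨-, -, l, hl⟩ := Finset.mem_filter.1 a.2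
    obtain ⟨-, ⟨l', hl'⟩, -⟩ := Finset.mem_filter.1 b.2
    refine ⟨l + n + l', by omega, ?_⟩
    rw [kpow_subtype]
    exact (kpow_add_pos (kpow_add_pos hl hpos) hl').trans_le (hstep a.2 b.2 _)
  · rw [kpow_subtype]
    exact hstep hxY hxY n

end KernelPowers

lemma ENNReal.tendsto_rpow_one_div_atTop {C : ℝ≥0∞} (h0 : C ≠ 0) (hC : C ≠ ⊤) :
    Tendsto (fun n : ℕ => C ^ (1 / (n : ℝ))) atTop (nhds 1) := by
  lift C to ℝ≥0 using hC
  have h0' : C ≠ 0 := by simpa using h0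
  have h : Tendsto (fun n : ℕ => C ^ (1 / (n : ℝ))) atTop (nhds (C ^ (0 : ℝ))) :=
    tendsto_const_nhds.nnrpow tendsto_one_div_atTop_nhds_zero_nat (Or.inl h0')
  rw [NNReal.rpow_zero] at h
  simpa [ENNReal.coe_rpow_of_ne_zero h0'] using ENNReal.tendsto_coe.2 h

lemma ENNReal.limsup_rpow_one_div_le {u v : ℕ → ℝ≥0∞} {c : ℝ≥0∞} (h0 : c ≠ 0) (hc : c ≠ ⊤)
    (m : ℕ) (h : ∀ n, c * u n ≤ v (n + m)) :
    limsup (fun n : ℕ => u n ^ (1 / (n : ℝ))) atTop ≤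
      limsup (fun n : ℕ => v n ^ (1 / (n : ℝ))) atTop := by
  refine le_of_forall_gt_imp_ge_of_dense fun r hr => ?_
  rcases eq_or_ne r ⊤ with rfl | hr_top
  · exact le_top
  have hr0 : r ≠ 0 := (pos_of_gt hr).ne'
  set C := c⁻¹ * r ^ m
  have hC0 : C ≠ 0 := mul_ne_zero (ENNReal.inv_ne_zero.2 hc) (pow_ne_zero _ hr0)
  have hC : C ≠ ⊤ := ENNReal.mul_ne_top (ENNReal.inv_ne_top.2 h0) (ENNReal.pow_ne_top hr_top)
  have hlim : Tendsto (fun n : ℕ => C ^ (1 / (n : ℝ)) * r) atTop (nhds r) := by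
    simpa using ENNReal.Tendsto.mul_const (ENNReal.tendsto_rpow_one_div_atTop hC0 hC)
      (Or.inr hr_top)
  rw [← hlim.limsup_eq]
  refine limsup_le_limsup ?_
  have hv : ∀ᶠ n : ℕ in atTop, v (n + m) ^ (1 / ((n + m : ℕ) : ℝ)) < r :=
    (tendsto_add_atTop_nat m).eventually (eventually_lt_of_limsup_lt hr)
  filter_upwards [hv, eventually_ge_atTop 1] with n hn hn1
  have hpos : (0 : ℝ) < n := by exact_mod_cast hn1
  have hpos' : (0 : ℝ) < (n + m : ℕ) := by exact_mod_cast (by omega : 0 < n + m)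
  have hvn : v (n + m) ≤ r ^ (n + m) := by
    rw [one_div] at hn
    simpa [-Nat.cast_add] using (ENNReal.rpow_inv_le_iff hpos').1 hn.le
  have hun : u n ≤ C * r ^ n := by
    calc u n = c⁻¹ * (c * u n) := by rw [← mul_assoc, ENNReal.inv_mul_cancel h0 hc, one_mul]
      _ ≤ c⁻¹ * r ^ (n + m) := by gcongr; exact (h n).trans hvn
      _ = C * r ^ n := by simp only [C]; ring
  calc u n ^ (1 / (n : ℝ)) ≤ (C * r ^ n) ^ (1 / (n : ℝ)) := by gcongr
    _ = C ^ (1 / (n : ℝ)) * r := by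
      rw [ENNReal.mul_rpow_of_nonneg _ _ (by positivity), one_div,
        ENNReal.pow_rpow_inv_natCast (by omega)]

section SpectralRadius

variable {X : Type*} [DecidableEq X] {k : X → X → ℝ≥0∞}

lemma rhoAt_self_le_rhoAt_self (hfin : ∀ n x y, kpow k n x y ≠ ⊤) (hirr : KIrred k) (x y : X) :
    rhoAt k y y ≤ rhoAt k x x := by
  obtain ⟨a, -, ha⟩ := hirr x y
  obtain ⟨b, -, hb⟩ := hirr y x
  refine ENNReal.limsup_rpow_one_div_le (mul_ne_zero ha.ne' hb.ne')
    (ENNReal.mul_ne_top (hfin a x y) (hfin b y x)) (a + b) fun n => ?_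
  calc kpow k a x y * kpow k b y x * kpow k n y y
      = kpow k a x y * kpow k n y y * kpow k b y x := by ring
    _ ≤ kpow k (a + n) x y * kpow k b y x := by gcongr; exact kpow_mul_le_kpow_add ..
    _ ≤ kpow k (a + n + b) x x := kpow_mul_le_kpow_add ..
    _ = kpow k (n + (a + b)) x x := by congr 1; omega

lemma rhoAt_subtype_le (Y : Finset X) (y : ↥Y) :
    rhoAt (fun a b : ↥Y => k a b) y y ≤ rhoAt k y y :=
  limsup_le_limsup <| .of_forall fun n =>
    ENNReal.rpow_le_rpow (kpow_subtype_le Y k n y y) (by positivity)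

lemma le_rhoAt_self {r : ℝ≥0∞} {n : ℕ} (hn : 1 ≤ n) {x : X} (h : r ^ n ≤ kpow k n x x) :
    r ≤ rhoAt k x x := by
  refine le_limsup_of_frequently_le' (Filter.frequently_atTop.2 fun N => ?_)
  have hN : 1 ≤ n * (N + 1) := Nat.mul_pos hn N.succ_pos
  refine ⟨n * (N + 1), by nlinarith, ?_⟩
  rw [one_div, ENNReal.le_rpow_inv_iff (by exact_mod_cast hN), ENNReal.rpow_natCast, pow_mul]
  exact (pow_le_pow_left' h _).trans (kpow_pow_le k n _ x)

end SpectralRadius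


/-- The spectral radius of an irreducible kernel is the supremum of the spectral radii of its
restrictions to finite irreducible subsets `Y ⊆ X`. -/
theorem rho_eq_sup_finite_sub {X : Type*} [Countable X] [DecidableEq X] (k : X → X → ℝ≥0∞)
    (hfin : ∀ n x y, kpow k n x y ≠ ⊤) (hirr : KIrred k) :
    ∀ x₀ : X, rhoAt k x₀ x₀ =
      ⨆ (Y : Finset X) (_ : KIrred (fun a b : ↥Y => k a b)) (y : ↥Y),
        rhoAt (fun a b : ↥Y => k a b) y y := by
  intro x₀
  refine le_antisymm (le_of_forall_lt_imp_le_of_dense fun r hr => ?_) ?_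
  · obtain ⟨n, hn, hn1⟩ :=
      ((frequently_lt_of_lt_limsup (by isBoundedDefault) hr).and_eventually
        (eventually_ge_atTop 1)).exists
    have hpow : r ^ n < kpow k n x₀ x₀ := by
      rw [one_div, ENNReal.lt_rpow_inv_iff (by exact_mod_cast hn1)] at hn
      simpa using hn
    obtain ⟨F, hF⟩ := lt_iSup_iff.1 (hpow.trans_le (kpow_le_iSup_kres k n x₀ x₀))
    obtain ⟨Y, hY, y, -, hle⟩ := exists_irreducible_kpow_le k F hn1 (pos_of_gt hF)
    exact le_iSup_of_le Y <| le_iSup_of_le hY <| le_iSup_of_le y <|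
      le_rhoAt_self hn1 (hF.le.trans hle)
  · exact iSup_le fun Y => iSup_le fun _ => iSup_le fun y =>
      (rhoAt_subtype_le Y y).trans (rhoAt_self_le_rhoAt_self hfin hirr x₀ y)
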